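/- In the rank-one quantum covering group U generated by E, F, K, K^{-1}, J with relations J central of order ≤ 2, KEK^{-1} = q²E, KFK^{-1} = q^{-2}F, EF - πFE = (JK - K^{-1})/(πq - q^{-1}), the following commutation formula holds for all N, M ≥ 0: E^{(N)} F^{(M)} = ∑_{t≥0} π^{MN - binom(t+1,2)} F^{(M-t)} [[K; 2t-M-N; t]] E^{(N-t)}, where [[K; a; t]] = ∏_{s=1}^{t} ((πq)^{a-s+1} JK - q^{s-a-1} K^{-1}) / ((πq)^s - q^{-s}). -/

import Mathlib

/- The ring `Aq = ℚ(q)[π]/(π²-1) ≅ ℚ(q) × ℚ(q)` (via π ↦ (1, -1), an isomorphism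
since 2 is invertible).  Division/inversion is componentwise (the total fraction ring). -/
noncomputable section

abbrev Aq : Type := RatFunc ℚ × RatFunc ℚ

/-- the element `q` -/
def qA : Aq := (RatFunc.X, RatFunc.X)

/-- the element `π`, satisfying `π² = 1` -/
def pA : Aq := (1, -1)

/-- The `(q,π)`-binomial coefficient
`[[a;t]] = (∏_{s=0}^{t-1} ((πq)^{a-s} - q^{s-a})) / (∏_{s=1}^{t} ((πq)^s - q^{-s}))`. -/
def qbinom (a : ℤ) (t : ℕ) : Aq :=
  (∏ s ∈ Finset.range t, ((pA * qA) ^ (a - (s : ℤ)) - qA ^ ((s : ℤ) - a))) /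
  (∏ s ∈ Finset.range t, ((pA * qA) ^ ((s : ℤ) + 1) - qA ^ (-((s : ℤ) + 1))))


/-- the `(q,π)`-integer `[m]` -/
def qint (m : ℕ) : Aq := ((pA * qA) ^ m - qA ^ (-(m : ℤ))) / (pA * qA - qA⁻¹)

/-- the `(q,π)`-factorial `[m]!` -/
def qfact (m : ℕ) : Aq := ∏ s ∈ Finset.range m, qint (s + 1)

section RankOne

variable {U : Type} [Ring U] [Algebra Aq U]

/-- divided power `E^{(n)} = E^n/[n]!` -/
def dp (E : U) (n : ℕ) : U := (qfact n)⁻¹ • E ^ n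

/-- `[[K;a;t]] = ∏_{s=1}^{t} ((πq)^{a-s+1} JK - q^{s-a-1} K^{-1})/((πq)^s - q^{-s})`
(the factors commute, and we take the product in the listed order) -/
def Kbinom (J K Ki : U) (a : ℤ) (t : ℕ) : U :=
  (((List.range t).map fun s =>
    (((pA * qA) ^ ((s : ℤ) + 1) - qA ^ (-((s : ℤ) + 1)))⁻¹ : Aq) •
      ((pA * qA) ^ (a - (s : ℤ)) • (J * K) - qA ^ ((s : ℤ) - a) • Ki))).prod

lemma qA_isUnit : IsUnit qA :=
  Prod.isUnit_iff.2 ⟨RatFunc.X_ne_zero.isUnit, RatFunc.X_ne_zero.isUnit⟩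

lemma pA_sq : pA ^ 2 = 1 := by
  ext <;> simp [pA]

lemma pA_isUnit : IsUnit pA := IsUnit.of_pow_eq_one pA_sq two_ne_zero

lemma Aq_zpow_add {x : Aq} (hx : IsUnit x) (a b : ℤ) : x ^ (a + b) = x ^ a * x ^ b := by
  obtain ⟨h1, h2⟩ := Prod.isUnit_iff.1 hx
  exact Prod.ext (zpow_add₀ h1.ne_zero a b) (zpow_add₀ h2.ne_zero a b)

lemma pA_zpow_mul_self (t : ℤ) : pA ^ t * pA ^ t = 1 := by
  rw [← mul_zpow, ← sq, pA_sq, one_zpow]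

lemma pA_zpow_neg (t : ℤ) : pA ^ (-t) = pA ^ t := by
  rw [zpow_neg]
  exact inv_eq_of_mul_eq_one_left (pA_zpow_mul_self t)

lemma qA_zpow_mul_neg (t : ℤ) : qA ^ t * qA ^ (-t) = 1 := by
  rw [← Aq_zpow_add qA_isUnit, add_neg_cancel, zpow_zero]

lemma RatFunc_X_pow_ne_one {n : ℕ} (hn : n ≠ 0) : (RatFunc.X : RatFunc ℚ) ^ n ≠ 1 := by
  rw [← RatFunc.algebraMap_X, ← map_pow, ← map_one (algebraMap (Polynomial ℚ) (RatFunc ℚ))]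
  intro h
  have := congrArg Polynomial.natDegree (RatFunc.algebraMap_injective ℚ h)
  simp [hn] at this

/-- The denominator `(πq)^n - q^{-n}`. -/
def qdiff (n : ℤ) : Aq := (pA * qA) ^ n - qA ^ (-n)

lemma qdiff_isUnit {n : ℕ} (hn : n ≠ 0) : IsUnit (qdiff n) := by
  have key : ∀ p : RatFunc ℚ, p ^ 2 = 1 →
      (p * RatFunc.X) ^ (n : ℤ) - RatFunc.X ^ (-(n : ℤ)) ≠ 0 := by
    intro p hp h
    have hX : (RatFunc.X : RatFunc ℚ) ^ n ≠ 0 := pow_ne_zero _ RatFunc.X_ne_zero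
    rw [sub_eq_zero, zpow_neg, zpow_natCast, zpow_natCast, mul_pow,
      ← mul_eq_one_iff_eq_inv₀ hX] at h
    have hpn : (p ^ n) ^ 2 = 1 := by rw [← pow_mul, mul_comm, pow_mul, hp, one_pow]
    refine RatFunc_X_pow_ne_one (n := n * 4) (by omega) ?_
    rw [pow_mul]
    linear_combination (p ^ n * RatFunc.X ^ n * RatFunc.X ^ n + 1) * h -
      (RatFunc.X ^ n) ^ 4 * hpn
  exact Prod.isUnit_iff.2 ⟨(key 1 (one_pow 2)).isUnit, (key (-1) neg_one_sq).isUnit⟩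

lemma qdiff_one : qdiff 1 = pA * qA - qA⁻¹ := by
  simp [qdiff]

lemma qdiff_one_isUnit : IsUnit (qdiff 1) := by
  simpa using qdiff_isUnit one_ne_zero

lemma qint_eq (n : ℕ) : qint n = qdiff n * (qdiff 1)⁻¹ := by
  rw [qdiff_one, qint, div_eq_mul_inv, qdiff, zpow_natCast]

lemma qint_isUnit {n : ℕ} (hn : n ≠ 0) : IsUnit (qint n) := by
  rw [qint_eq]
  exact (qdiff_isUnit hn).mul qdiff_one_isUnit.inv

lemma qdiff_mul_qA_zpow (n b t : ℤ) :
    qdiff n * (pA * qA) ^ b =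
        pA ^ t * qdiff (n - t) * (pA * qA) ^ (b - t) + qdiff t * (pA * qA) ^ (b + n - t) ∧
      qdiff n * qA ^ (-b) =
        pA ^ t * qdiff (n - t) * qA ^ (-(b - t)) + qdiff t * qA ^ (-(b + n - t)) := by
  have hp := pA_zpow_mul_self t
  have hq := qA_zpow_mul_neg t
  have e1 : -(n - t) = t + -n := by ring
  have e2 : -(b - t) = t + -b := by ring
  have e3 : -(b + n - t) = t + (-b + -n) := by ring
  simp only [qdiff, e1, e2, e3]
  simp only [sub_eq_add_neg, mul_zpow, Aq_zpow_add qA_isUnit, Aq_zpow_add pA_isUnit, pA_zpow_neg]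
  generalize qA ^ t = T at *
  generalize qA ^ (-t) = T' at *
  generalize pA ^ t = P at *
  generalize pA ^ n = Pn at *
  generalize pA ^ b = Pb at *
  generalize qA ^ b = B at *
  generalize qA ^ (-b) = B' at *
  generalize qA ^ n = X at *
  generalize qA ^ (-n) = X' at *
  constructor
  · grind
  · grind

lemma E_dp_succ {U : Type} [Ring U] [Algebra Aq U] (E : U) (n : ℕ) :
    E * dp E n = qint (n + 1) • dp E (n + 1) := by
  rw [dp, dp, qfact, qfact, Finset.prod_range_succ, mul_inv, smul_smul, mul_left_comm,
    (qint_isUnit n.succ_ne_zero).mul_inv_cancel, mul_one, mul_smul_comm, pow_succ']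

/-- The divided power indexed by integers, zero in negative degree. -/
def dpInt (E : U) (n : ℤ) : U := if n < 0 then 0 else dp E n.toNat

lemma dpInt_natCast (E : U) (n : ℕ) : dpInt E n = dp E n := by
  simp [dpInt]

lemma dpInt_of_neg (E : U) {n : ℤ} (hn : n < 0) : dpInt E n = 0 := if_pos hn

lemma mul_dpInt (E : U) (n : ℤ) :
    E * dpInt E n = (qdiff (n + 1) * (qdiff 1)⁻¹) • dpInt E (n + 1) := by
  rcases lt_trichotomy n (-1) with h | rfl | h
  · rw [dpInt_of_neg E (by omega), dpInt_of_neg E (by omega), mul_zero, smul_zero]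
  · simp [dpInt, qdiff]
  · lift n to ℕ using by omega
    have := E_dp_succ E n
    rw [qint_eq, ← dpInt_natCast, ← dpInt_natCast] at this
    simpa using this

/-- The numerator `(πq)^a JK - q^{-a} K⁻¹` of the factors of `[[K;a;t]]`. -/
def weight (J K Ki : U) (a : ℤ) : U := (pA * qA) ^ a • (J * K) - qA ^ (-a) • Ki

lemma qdiff_smul_weight (J K Ki : U) (n b t : ℤ) :
    qdiff n • weight J K Ki b =
      (pA ^ t * qdiff (n - t)) • weight J K Ki (b - t) + qdiff t • weight J K Ki (b + n - t) := by
  obtain ⟨h1, h2⟩ := qdiff_mul_qA_zpow n b t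
  simp only [weight, smul_sub, smul_smul, h1, h2, add_smul]
  abel

lemma pA_mul_qA_zpow_sub_two (a : ℤ) : (pA * qA) ^ (a - 2) = (pA * qA) ^ a * qA ^ (-2 : ℤ) := by
  rw [sub_eq_add_neg, Aq_zpow_add (pA_isUnit.mul qA_isUnit), mul_zpow _ _ (-2), pA_zpow_neg]
  have : pA ^ (2 : ℤ) = 1 := by exact_mod_cast pA_sq
  rw [this, one_mul]

lemma qA_zpow_neg_sub_two (a : ℤ) : qA ^ (-(a - 2)) = qA ^ (-a) * qA ^ (2 : ℤ) := by
  rw [← Aq_zpow_add qA_isUnit]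
  congr 1
  ring

lemma inv_qcomm {K Ki X : U} (hKKi : K * Ki = 1) (hKiK : Ki * K = 1) {c : ℤ}
    (h : K * X = qA ^ c • (X * K)) : X * Ki = qA ^ c • (Ki * X) := by
  calc X * Ki = Ki * (K * X) * Ki := by rw [← mul_assoc, hKiK, one_mul]
    _ = qA ^ c • (Ki * X) := by
      rw [h, mul_smul_comm, smul_mul_assoc, mul_assoc, mul_assoc, hKKi, mul_one]

lemma qcomm_symm {X Y : U} {c : ℤ} (h : X = qA ^ c • Y) : Y = qA ^ (-c) • X := by
  rw [h, smul_smul, mul_comm, qA_zpow_mul_neg, one_smul]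

lemma mul_weight {E K Ki J : U} (hJE : J * E = E * J) (hKKi : K * Ki = 1) (hKiK : Ki * K = 1)
    (hKE : K * E = qA ^ 2 • (E * K)) (a : ℤ) :
    E * weight J K Ki a = weight J K Ki (a - 2) * E := by
  have hKE' : K * E = qA ^ (2 : ℤ) • (E * K) := by exact_mod_cast hKE
  have h1 : E * (J * K) = qA ^ (-2 : ℤ) • (J * K * E) := by
    rw [← mul_assoc, ← hJE, mul_assoc, qcomm_symm hKE', mul_smul_comm, mul_assoc]
  rw [weight, weight, mul_sub, sub_mul, mul_smul_comm, mul_smul_comm, h1,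
    inv_qcomm hKKi hKiK hKE', smul_mul_assoc, smul_mul_assoc, smul_smul, smul_smul,
    pA_mul_qA_zpow_sub_two, qA_zpow_neg_sub_two]

lemma weight_mul {F K Ki J : U} (hJF : J * F = F * J) (hKKi : K * Ki = 1) (hKiK : Ki * K = 1)
    (hKF : K * F = qA ^ (-2 : ℤ) • (F * K)) (a : ℤ) :
    weight J K Ki a * F = F * weight J K Ki (a - 2) := by
  have h1 : J * K * F = qA ^ (-2 : ℤ) • (F * (J * K)) := by
    rw [mul_assoc, hKF, mul_smul_comm, ← mul_assoc, hJF, mul_assoc]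
  have h2 := qcomm_symm (inv_qcomm hKKi hKiK hKF)
  rw [neg_neg] at h2
  rw [weight, weight, mul_sub, sub_mul, smul_mul_assoc, smul_mul_assoc, h1, h2,
    mul_smul_comm, mul_smul_comm, smul_smul, smul_smul,
    pA_mul_qA_zpow_sub_two, qA_zpow_neg_sub_two]

lemma Kbinom_zero (J K Ki : U) (a : ℤ) : Kbinom J K Ki a 0 = 1 := by
  simp [Kbinom]

lemma qdiff_smul_Kbinom_succ (J K Ki : U) (a : ℤ) (t : ℕ) :
    qdiff (t + 1) • Kbinom J K Ki a (t + 1) = Kbinom J K Ki a t * weight J K Ki (a - t) := by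
  have hu : IsUnit (qdiff (t + 1)) := by exact_mod_cast qdiff_isUnit t.succ_ne_zero
  have h : Kbinom J K Ki a (t + 1) =
      Kbinom J K Ki a t * ((qdiff (t + 1))⁻¹ • weight J K Ki (a - t)) := by
    simp [Kbinom, List.range_succ, qdiff, weight]
  rw [h, mul_smul_comm, smul_smul, hu.mul_inv_cancel, one_smul]

lemma qdiff_smul_Kbinom_succ' (J K Ki : U) (a : ℤ) (t : ℕ) :
    qdiff (t + 1) • Kbinom J K Ki a (t + 1) = weight J K Ki a * Kbinom J K Ki (a - 1) t := by
  induction t with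
  | zero => simpa [Kbinom_zero] using qdiff_smul_Kbinom_succ J K Ki a 0
  | succ t ih =>
    have hu : IsUnit (qdiff (t + 1)) := by exact_mod_cast qdiff_isUnit t.succ_ne_zero
    rw [qdiff_smul_Kbinom_succ, ← hu.smul_left_cancel, ← smul_mul_assoc, ih, mul_assoc,
      ← mul_smul_comm, qdiff_smul_Kbinom_succ]
    congr 3
    push_cast
    ring

section Commutation

variable {E F K Ki J : U}

lemma commute_Kbinom (hcomm : ∀ a b : ℤ, Commute (weight J K Ki a) (weight J K Ki b))
    (a b : ℤ) (t : ℕ) : Commute (weight J K Ki a) (Kbinom J K Ki b t) := by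
  induction t with
  | zero => simp [Kbinom_zero]
  | succ t ih =>
    have hu : IsUnit (qdiff (t + 1)) := by exact_mod_cast qdiff_isUnit t.succ_ne_zero
    have h := ih.mul_right (hcomm a (b - t))
    rw [← qdiff_smul_Kbinom_succ] at h
    unfold Commute SemiconjBy at h ⊢
    rwa [mul_smul_comm, smul_mul_assoc, hu.smul_left_cancel] at h

lemma mul_Kbinom (hE : ∀ a : ℤ, E * weight J K Ki a = weight J K Ki (a - 2) * E)
    (a : ℤ) (t : ℕ) : E * Kbinom J K Ki a t = Kbinom J K Ki (a - 2) t * E := by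
  induction t with
  | zero => simp [Kbinom_zero]
  | succ t ih =>
    have hu : IsUnit (qdiff (t + 1)) := by exact_mod_cast qdiff_isUnit t.succ_ne_zero
    rw [← hu.smul_left_cancel, ← mul_smul_comm, ← smul_mul_assoc, qdiff_smul_Kbinom_succ,
      qdiff_smul_Kbinom_succ, ← mul_assoc, ih, mul_assoc, hE, mul_assoc, sub_right_comm]

lemma Kbinom_recurrence (hcomm : ∀ a b : ℤ, Commute (weight J K Ki a) (weight J K Ki b))
    (n b : ℤ) (t : ℕ) :
    qdiff n • Kbinom J K Ki b (t + 1) =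
      (pA ^ (t + 1 : ℤ) * qdiff (n - (t + 1))) • Kbinom J K Ki (b - 1) (t + 1) +
        weight J K Ki (b + n - (t + 1)) * Kbinom J K Ki (b - 1) t := by
  have hu : IsUnit (qdiff (t + 1)) := by exact_mod_cast qdiff_isUnit t.succ_ne_zero
  rw [← hu.smul_left_cancel, smul_add, smul_comm (qdiff (t + 1)), smul_comm (qdiff (t + 1)),
    qdiff_smul_Kbinom_succ', qdiff_smul_Kbinom_succ, ← (commute_Kbinom hcomm _ _ t).eq,
    ← smul_mul_assoc, ← smul_mul_assoc, ← smul_mul_assoc, ← add_mul,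
    qdiff_smul_weight J K Ki n b (t + 1), sub_sub, add_comm (1 : ℤ)]

lemma mul_pow_succ (hF : ∀ a : ℤ, weight J K Ki a * F = F * weight J K Ki (a - 2))
    (hEF : E * F = pA • (F * E) + (pA * qA - qA⁻¹)⁻¹ • weight J K Ki 0) (m : ℕ) :
    E * F ^ (m + 1) = pA ^ (m + 1) • (F ^ (m + 1) * E) +
      (pA ^ m * qint (m + 1) * (qdiff 1)⁻¹) • (F ^ m * weight J K Ki (-m)) := by
  rw [← qdiff_one] at hEF
  have hq := qdiff_one_isUnit.mul_inv_cancel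
  induction m with
  | zero => simp [qint_eq, hEF, hq]
  | succ m ih =>
    have key := qdiff_smul_weight J K Ki (m + 2) (-(m + 1)) 1
    rw [show (-(m + 1 : ℤ)) - 1 = -m - 2 by ring, show (m + 2 : ℤ) - 1 = m + 1 by ring,
      show (-(m + 1 : ℤ)) + (m + 2) - 1 = 0 by ring, zpow_one] at key
    have key' := congrArg (fun x => F ^ (m + 1) * x) key
    simp only [mul_add, mul_smul_comm] at key'
    rw [pow_succ F (m + 1), ← mul_assoc, ih, add_mul, smul_mul_assoc, smul_mul_assoc,
      mul_assoc (F ^ (m + 1)), hEF, mul_assoc (F ^ m), hF,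
      ← mul_assoc (F ^ m), ← pow_succ, mul_add, mul_smul_comm, mul_smul_comm,
      ← mul_assoc, ← pow_succ, qint_eq, qint_eq]
    push_cast
    rw [show (m + 1 + 1 : ℤ) = m + 2 by ring]
    have hp : pA ^ (m + 1) * pA = pA ^ m := by rw [pow_succ, mul_assoc, ← sq, pA_sq, mul_one]
    have e : pA ^ (m + 1) * (qdiff (m + 2) * (qdiff 1)⁻¹) * (qdiff 1)⁻¹ =
        pA ^ (m + 1) * (qdiff 1)⁻¹ * (qdiff 1)⁻¹ * qdiff (m + 2) := by ring
    rw [e, mul_smul _ (qdiff (m + 2)), key']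
    simp only [smul_add, smul_smul]
    rw [add_right_comm, add_assoc, ← pow_succ]
    congr 2
    · congr 1
      linear_combination (-(qdiff 1)⁻¹ * (qdiff 1)⁻¹ * qdiff (m + 1)) * hp
    · congr 1
      linear_combination (-pA ^ (m + 1) * (qdiff 1)⁻¹) * hq

lemma mul_dp_succ (hF : ∀ a : ℤ, weight J K Ki a * F = F * weight J K Ki (a - 2))
    (hEF : E * F = pA • (F * E) + (pA * qA - qA⁻¹)⁻¹ • weight J K Ki 0) (m : ℕ) :
    E * dp F (m + 1) = pA ^ (m + 1) • (dp F (m + 1) * E) +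
      (pA ^ m * (qdiff 1)⁻¹) • (dp F m * weight J K Ki (-m)) := by
  have h : (qfact m)⁻¹ = (qfact (m + 1))⁻¹ * qint (m + 1) := by
    rw [qfact, qfact, Finset.prod_range_succ, mul_inv, mul_assoc,
      (qint_isUnit m.succ_ne_zero).inv_mul_cancel, mul_one]
  rw [dp, dp, mul_smul_comm, mul_pow_succ hF hEF, h]
  simp only [smul_mul_assoc, smul_add, smul_smul]
  congr 2 <;> ring

lemma mul_dpInt_F (hF : ∀ a : ℤ, weight J K Ki a * F = F * weight J K Ki (a - 2))
    (hEF : E * F = pA • (F * E) + (pA * qA - qA⁻¹)⁻¹ • weight J K Ki 0) (m : ℤ) :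
    E * dpInt F m = pA ^ m • (dpInt F m * E) +
      (pA ^ (m - 1) * (qdiff 1)⁻¹) • (dpInt F (m - 1) * weight J K Ki (1 - m)) := by
  rcases lt_trichotomy m 0 with h | rfl | h
  · simp [dpInt_of_neg F h, dpInt_of_neg F (show m - 1 < 0 by omega)]
  · simp [dpInt, dp, qfact]
  · obtain ⟨n, rfl⟩ : ∃ n : ℕ, m = n + 1 := ⟨(m - 1).toNat, by omega⟩
    have := mul_dp_succ hF hEF n
    rw [← dpInt_natCast, ← dpInt_natCast] at this
    rw [add_sub_cancel_right, sub_add_cancel_right]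
    exact_mod_cast this

/-- The `t`-th summand of the commutation formula, defined for every `t`. -/
def commTerm (E F K Ki J : U) (N M t : ℕ) : U :=
  pA ^ ((M : ℤ) * (N : ℤ) - ((t + 1).choose 2 : ℤ)) •
    (dpInt F (M - t) * Kbinom J K Ki (2 * (t : ℤ) - M - N) t * dpInt E (N - t))

/-- The part of `E * commTerm E F K Ki J N M t` in which `E` has been moved to the right. -/
def commTermRight (E F K Ki J : U) (N M t : ℕ) : U :=
  (pA ^ ((M : ℤ) * (N : ℤ) - ((t + 1).choose 2 : ℤ)) * pA ^ (M - t : ℤ) *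
      (qdiff (N + 1 - t) * (qdiff 1)⁻¹)) •
    (dpInt F (M - t) * Kbinom J K Ki (2 * (t : ℤ) - M - N - 2) t * dpInt E (N + 1 - t))

/-- The part of `E * commTerm E F K Ki J N M t` in which `E` has cancelled a factor `F`. -/
def commTermCancel (E F K Ki J : U) (N M t : ℕ) : U :=
  (pA ^ ((M : ℤ) * (N : ℤ) - ((t + 1).choose 2 : ℤ)) * pA ^ (M - t - 1 : ℤ) * (qdiff 1)⁻¹) •
    (dpInt F (M - t - 1) * (weight J K Ki (1 - (M - t)) *
      Kbinom J K Ki (2 * (t : ℤ) - M - N) t) * dpInt E (N - t))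

lemma mul_commTerm (hE : ∀ a : ℤ, E * weight J K Ki a = weight J K Ki (a - 2) * E)
    (hF : ∀ a : ℤ, weight J K Ki a * F = F * weight J K Ki (a - 2))
    (hEF : E * F = pA • (F * E) + (pA * qA - qA⁻¹)⁻¹ • weight J K Ki 0) (N M t : ℕ) :
    E * commTerm E F K Ki J N M t =
      commTermRight E F K Ki J N M t + commTermCancel E F K Ki J N M t := by
  rw [commTerm, commTermRight, commTermCancel, mul_smul_comm, ← mul_assoc, ← mul_assoc,
    mul_dpInt_F hF hEF, add_mul, add_mul, smul_mul_assoc, smul_mul_assoc, mul_assoc _ E,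
    mul_Kbinom hE, smul_mul_assoc, smul_mul_assoc, ← mul_assoc, mul_assoc _ E, mul_dpInt,
    mul_smul_comm, show (N : ℤ) - t + 1 = N + 1 - t by ring]
  simp only [mul_assoc, smul_add, smul_smul]

lemma qint_smul_commTerm_zero (N M : ℕ) :
    qint (N + 1) • commTerm E F K Ki J (N + 1) M 0 = commTermRight E F K Ki J N M 0 := by
  rw [commTerm, commTermRight, qint_eq, Kbinom_zero, Kbinom_zero, smul_smul]
  push_cast
  have : (M : ℤ) * (N + 1) - ((0 + 1).choose 2 : ℕ) =
      (M * N - ((0 + 1).choose 2 : ℕ)) + (M - 0) := by ring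
  rw [this, Aq_zpow_add pA_isUnit, sub_zero ((N : ℤ) + 1), mul_comm (qdiff _ * _)]

lemma qint_smul_commTerm_succ
    (hcomm : ∀ a b : ℤ, Commute (weight J K Ki a) (weight J K Ki b)) (N M t : ℕ) :
    qint (N + 1) • commTerm E F K Ki J (N + 1) M (t + 1) =
      commTermRight E F K Ki J N M (t + 1) + commTermCancel E F K Ki J N M t := by
  have hch : ((t + 1 + 1).choose 2 : ℤ) = (t + 1).choose 2 + (t + 1) := by
    rw [Nat.choose_succ_succ' (t + 1) 1, Nat.choose_one_right]
    push_cast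
    ring
  have key := Kbinom_recurrence hcomm (N + 1) (2 * (t + 1) - M - (N + 1)) t
  have key' := congrArg (fun x => dpInt F (M - (t + 1)) * x * dpInt E (N + 1 - (t + 1))) key
  simp only [mul_add (dpInt F _), add_mul _ _ (dpInt E _), mul_smul_comm, smul_mul_assoc] at key'
  rw [commTerm, commTermRight, commTermCancel, qint_eq, hch]
  push_cast
  rw [smul_smul, show qdiff (N + 1) * (qdiff 1)⁻¹ *
      pA ^ ((M : ℤ) * (N + 1) - ((t + 1).choose 2 + (t + 1))) =
      (qdiff 1)⁻¹ * pA ^ ((M : ℤ) * (N + 1) - ((t + 1).choose 2 + (t + 1))) * qdiff (N + 1) by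
    ring, mul_smul, key', smul_add, smul_smul]
  congr 1
  · congr 1
    · rw [show (M : ℤ) * (N + 1) - ((t + 1).choose 2 + (t + 1)) =
        (M * N - ((t + 1).choose 2 + (t + 1))) + (M - (t + 1)) + (t + 1) by ring,
        Aq_zpow_add pA_isUnit, Aq_zpow_add pA_isUnit]
      linear_combination ((qdiff 1)⁻¹ * pA ^ ((M : ℤ) * N - ((t + 1).choose 2 + (t + 1))) *
        pA ^ ((M : ℤ) - (t + 1)) * qdiff (N + 1 - (t + 1))) * pA_zpow_mul_self (t + 1)
    · congr 3
      ring
  · rw [show (M : ℤ) * (N + 1) - ((t + 1).choose 2 + (t + 1)) =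
        (M * N - (t + 1).choose 2) + (M - t - 1) by ring,
        Aq_zpow_add pA_isUnit, mul_comm (qdiff 1)⁻¹, ← sub_sub (M : ℤ), add_sub_add_right_eq_sub,
        show 2 * (t + 1 : ℤ) - M - (N + 1) + (N + 1) - (t + 1) = 1 - (M - t) by ring,
        show 2 * (t + 1 : ℤ) - M - (N + 1) - 1 = 2 * t - M - N by ring]

lemma dp_mul_dp (hcomm : ∀ a b : ℤ, Commute (weight J K Ki a) (weight J K Ki b))
    (hE : ∀ a : ℤ, E * weight J K Ki a = weight J K Ki (a - 2) * E)
    (hF : ∀ a : ℤ, weight J K Ki a * F = F * weight J K Ki (a - 2))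
    (hEF : E * F = pA • (F * E) + (pA * qA - qA⁻¹)⁻¹ • weight J K Ki 0) (N M : ℕ) :
    dp E N * dp F M = ∑ t ∈ Finset.range (N + 1), commTerm E F K Ki J N M t := by
  induction N with
  | zero =>
    have h0 : dp E 0 = 1 := by simp [dp, qfact]
    have h1 : dpInt E 0 = 1 := by simp [dpInt, h0]
    simp [commTerm, Kbinom_zero, h0, h1, dpInt_natCast]
  | succ N ih =>
    have hlast : commTermRight E F K Ki J N M (N + 1) = 0 := by
      simp [commTermRight, qdiff]
    rw [← (qint_isUnit N.succ_ne_zero).smul_left_cancel, ← smul_mul_assoc, Nat.succ_eq_add_one,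
      ← E_dp_succ, mul_assoc, ih, Finset.mul_sum, Finset.smul_sum,
      Finset.sum_range_succ' _ (N + 1), qint_smul_commTerm_zero]
    simp only [mul_commTerm hE hF hEF, qint_smul_commTerm_succ hcomm, Finset.sum_add_distrib]
    rw [add_right_comm, ← Finset.sum_range_succ' (commTermRight E F K Ki J N M),
      Finset.sum_range_succ _ (N + 1), hlast, add_zero]

end Commutation

/-- Rank-one commutation formula
`E^{(N)} F^{(M)} = ∑_{t≥0} π^{MN-binom(t+1,2)} F^{(M-t)} [[K;2t-M-N;t]] E^{(N-t)}`
in the rank-one quantum covering group (all terms with `t > min M N` vanish). -/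
theorem rank_one_commutation (U : Type) [Ring U] [Algebra Aq U]
    (E F K Ki J : U)
    (hJ2 : J ^ 2 = 1)
    (hJE : J * E = E * J) (hJF : J * F = F * J) (hJK : J * K = K * J)
    (hJKi : J * Ki = Ki * J)
    (hKKi : K * Ki = 1) (hKiK : Ki * K = 1)
    (hKE : K * E = qA ^ 2 • (E * K))
    (hKF : K * F = (qA ^ (-2 : ℤ)) • (F * K))
    (hEF : E * F - pA • (F * E) = ((pA * qA - qA⁻¹)⁻¹ : Aq) • (J * K - Ki))
    (N M : ℕ) :
    dp E N * dp F M =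
      ∑ t ∈ Finset.range (min M N + 1),
        pA ^ ((M : ℤ) * (N : ℤ) - ((t + 1).choose 2 : ℤ)) •
          (dp F (M - t) * Kbinom J K Ki (2 * (t : ℤ) - M - N) t * dp E (N - t)) := by
  have hB : ∀ a : ℤ, Commute (weight J K Ki a) (J * K) ∧ Commute (weight J K Ki a) Ki := by
    intro a
    have h1 : Commute Ki (J * K) := by
      unfold Commute SemiconjBy
      rw [← mul_assoc, ← hJKi, mul_assoc, mul_assoc, hKKi, hKiK]
    exact ⟨((Commute.refl _).smul_left _).sub_left (h1.smul_left _),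
      (h1.symm.smul_left _).sub_left ((Commute.refl _).smul_left _)⟩
  have hcomm : ∀ a b : ℤ, Commute (weight J K Ki a) (weight J K Ki b) := fun a b =>
    ((hB a).1.smul_right _).sub_right ((hB a).2.smul_right _)
  have hE := mul_weight hJE hKKi hKiK hKE
  have hF := weight_mul hJF hKKi hKiK hKF
  have hEF' : E * F = pA • (F * E) + (pA * qA - qA⁻¹)⁻¹ • weight J K Ki 0 := by
    rw [sub_eq_iff_eq_add] at hEF
    rw [hEF, add_comm]
    simp [weight]
  rw [dp_mul_dp hcomm hE hF hEF' N M]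
  have hsub : Finset.range (min M N + 1) ⊆ Finset.range (N + 1) :=
    Finset.range_subset_range.2 (by omega)
  rw [← Finset.sum_subset hsub]
  · refine Finset.sum_congr rfl fun t ht => ?_
    have ht' : t ≤ M ∧ t ≤ N := by
      have := Finset.mem_range.1 ht
      omega
    rw [commTerm, ← Nat.cast_sub ht'.1, ← Nat.cast_sub ht'.2, dpInt_natCast, dpInt_natCast]
  · intro t ht ht'
    rw [Finset.mem_range] at ht ht'
    rw [commTerm, dpInt_of_neg F (show (M : ℤ) - t < 0 by omega)]
    simp

end RankOne
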